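/- Let n ≥ 50k² and k ≥ 2, X = {1,...,n}, and let F be an intersecting family of k-subsets of X. Let A = {A ⊆ X : |A| = k, |A ∩ {1,2,3}| ≥ 2}. Then the number of distinct intersections F ∩ F' over distinct F, F' ∈ F is at most the number of distinct intersections A ∩ A' over distinct A, A' ∈ A. -/

import Mathlib

open Finset

/-- A family of finite sets is intersecting if any two members meet. -/
def Intersecting (F : Finset (Finset ℕ)) : Prop :=
  ∀ A ∈ F, ∀ B ∈ F, (A ∩ B).Nonempty

/-- `T` is a transversal of `F` inside `{1,…,n}` of size at most `k`. -/
def Transversal (n k : ℕ) (F : Finset (Finset ℕ)) (T : Finset ℕ) : Prop :=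
  T ⊆ Finset.Icc 1 n ∧ T.card ≤ k ∧ ∀ A ∈ F, (T ∩ A).Nonempty

/-- `B` is an inclusion-minimal transversal of `F`. -/
def MinTrans (n k : ℕ) (F : Finset (Finset ℕ)) (B : Finset ℕ) : Prop :=
  Transversal n k F B ∧ ∀ T, Transversal n k F T → T ⊆ B → T = B

/-- `F` is a saturated intersecting family of `k`-subsets of `{1,…,n}`. -/
def Saturated (n k : ℕ) (F : Finset (Finset ℕ)) : Prop :=
  Intersecting F ∧
    ∀ G ∈ (Finset.Icc 1 n).powersetCard k, G ∉ F → ¬ Intersecting (insert G F)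

/-- The family of distinct pairwise intersections of distinct members of `F`. -/
def interFam (F : Finset (Finset ℕ)) : Finset (Finset ℕ) :=
  ((F ×ˢ F).filter fun p => p.1 ≠ p.2).image fun p => p.1 ∩ p.2

lemma aux_branch (k : ℕ) (𝒢 : Finset (Finset ℕ)) (h𝒢 : ∀ G ∈ 𝒢, G.card ≤ k) (m : ℕ) :
    ∀ S0 : Finset ℕ, (∀ S, S0 ⊆ S → S.card < S0.card + m → ∃ G ∈ 𝒢, Disjoint S G) →
    ∃ 𝒮 : Finset (Finset ℕ), 𝒮.card ≤ k ^ m ∧ (∀ S ∈ 𝒮, S.card = S0.card + m) ∧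
      ∀ P, S0 ⊆ P → (∀ G ∈ 𝒢, ¬ Disjoint P G) → ∃ S ∈ 𝒮, S ⊆ P := by
  induction m with
  | zero =>
    intro S0 _
    exact ⟨{S0}, by simp, by simp, fun P hP _ => ⟨S0, by simp, hP⟩⟩
  | succ m ih =>
    intro S0 h
    obtain ⟨G, hG, hd⟩ := h S0 (Finset.Subset.refl _) (by omega)
    have hc : ∀ g ∈ G, (insert g S0).card = S0.card + 1 := by
      intro g hg
      exact Finset.card_insert_of_notMem (fun h' => Finset.disjoint_left.1 hd h' hg)
    have key : ∀ g : ℕ, ∃ 𝒮 : Finset (Finset ℕ), g ∈ G → 𝒮.card ≤ k ^ m ∧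
        (∀ S ∈ 𝒮, S.card = (insert g S0).card + m) ∧
        ∀ P, insert g S0 ⊆ P → (∀ G ∈ 𝒢, ¬ Disjoint P G) → ∃ S ∈ 𝒮, S ⊆ P := by
      intro g
      by_cases hg : g ∈ G
      · obtain ⟨𝒮, h𝒮⟩ := ih (insert g S0) (by
          intro S hS hS'
          rw [hc g hg] at hS'
          exact h S ((Finset.subset_insert _ _).trans hS) (by omega))
        exact ⟨𝒮, fun _ => h𝒮⟩
      · exact ⟨∅, fun h => absurd h hg⟩
    choose f hf using key
    refine ⟨G.biUnion f, ?_, ?_, ?_⟩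
    · calc (G.biUnion f).card ≤ G.card * k ^ m :=
            Finset.card_biUnion_le_card_mul _ _ _ (fun g hg => (hf g hg).1)
        _ ≤ k * k ^ m := Nat.mul_le_mul_right _ (h𝒢 G hG)
        _ = k ^ (m + 1) := by ring
    · intro S hS
      obtain ⟨g, hg, hS⟩ := Finset.mem_biUnion.1 hS
      have := (hf g hg).2.1 S hS
      rw [hc g hg] at this
      omega
    · intro P hP hPt
      obtain ⟨g, hgP, hgG⟩ := Finset.not_disjoint_iff.1 (hPt G hG)
      obtain ⟨S, hS, hSP⟩ := (hf g hgG).2.2 P (Finset.insert_subset hgP hP) hPt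
      exact ⟨S, Finset.mem_biUnion.2 ⟨g, hgG, hS⟩, hSP⟩

lemma aux_branch2 (k p : ℕ) (hp : 1 ≤ p) (𝒢 : Finset (Finset ℕ)) (h𝒢 : ∀ G ∈ 𝒢, G.card ≤ k)
    (Q : Finset ℕ) (h : ∀ S : Finset ℕ, S.card < p → ∃ G ∈ 𝒢, Disjoint S G) :
    ∃ 𝒮 : Finset (Finset ℕ), 𝒮.card ≤ Q.card * k ^ (p - 1) ∧ (∀ S ∈ 𝒮, S.card = p) ∧
      ∀ P, ¬ Disjoint P Q → (∀ G ∈ 𝒢, ¬ Disjoint P G) → ∃ S ∈ 𝒮, S ⊆ P := by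
  have key : ∀ e : ℕ, _ := fun e => aux_branch k 𝒢 h𝒢 (p - 1) {e} (by
    intro S _ hS
    rw [Finset.card_singleton] at hS
    exact h S (by omega))
  choose f hf using key
  refine ⟨Q.biUnion f, Finset.card_biUnion_le_card_mul _ _ _ (fun g _ => (hf g).1), ?_, ?_⟩
  · intro S hS
    obtain ⟨g, hg, hS⟩ := Finset.mem_biUnion.1 hS
    have := (hf g).2.1 S hS
    rw [Finset.card_singleton] at this
    omega
  · intro P hP hPt
    obtain ⟨g, hgP, hgG⟩ := Finset.not_disjoint_iff.1 hP
    obtain ⟨S, hS, hSP⟩ := (hf g).2.2 P (by simpa using hgP) hPt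
    exact ⟨S, Finset.mem_biUnion.2 ⟨g, hgG, hS⟩, hSP⟩

lemma aux_choose_step (n k s : ℕ) (hk : 2 ≤ k) (hn : 50 * k ^ 2 ≤ n) (hs : 1 ≤ s)
    (hsk : s + 1 ≤ k - 1) :
    (50 * k) * (n - (s + 1)).choose (k - 1 - (s + 1)) ≤ (n - s).choose (k - 1 - s) := by
  obtain ⟨j, rfl⟩ : ∃ j, k = s + j + 2 := ⟨k - s - 2, by omega⟩
  have hkn : s + 1 ≤ n := by nlinarith
  obtain ⟨N, rfl⟩ : ∃ N, n = s + 1 + N := ⟨n - (s+1), by omega⟩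
  have e1 : s + 1 + N - (s + 1) = N := by omega
  have e2 : s + j + 2 - 1 - (s + 1) = j := by omega
  have e3 : s + 1 + N - s = N + 1 := by omega
  have e4 : s + j + 2 - 1 - s = j + 1 := by omega
  rw [e1, e2, e3, e4]
  have h := Nat.add_one_mul_choose_eq N j
  have h2 : 50 * (s + j + 2) * (j + 1) ≤ N + 1 := by nlinarith
  have : (50 * (s + j + 2) * N.choose j) * (j + 1) ≤ (N + 1).choose (j + 1) * (j + 1) := by
    rw [← h]
    nlinarith [Nat.mul_le_mul_right (N.choose j) h2]
  exact Nat.le_of_mul_le_mul_right this (by omega)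

lemma aux_choose (n k : ℕ) (hk : 2 ≤ k) (hn : 50 * k ^ 2 ≤ n) (s : ℕ) (hs : 1 ≤ s) :
    s ≤ k - 1 → (50 * k) ^ (s - 1) * (n - s).choose (k - 1 - s) ≤ (n - 1).choose (k - 2) := by
  induction s, hs using Nat.le_induction with
  | base => intro _; simp [Nat.sub_sub]
  | succ s hs ih =>
    intro h
    have h1 := aux_choose_step n k s hk hn hs h
    have h2 := ih (by omega)
    obtain ⟨r, rfl⟩ : ∃ r, s = r + 1 := ⟨s - 1, by omega⟩
    calc (50 * k) ^ (r + 1 + 1 - 1) * (n - (r + 1 + 1)).choose (k - 1 - (r + 1 + 1))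
        = (50 * k) ^ r * ((50 * k) * (n - (r + 1 + 1)).choose (k - 1 - (r + 1 + 1))) := by
          simp only [Nat.add_sub_cancel]; ring
      _ ≤ (50 * k) ^ r * ((n - (r + 1)).choose (k - 1 - (r + 1))) := Nat.mul_le_mul_left _ h1
      _ ≤ _ := by simpa using h2

lemma aux_cnt (n k : ℕ) (hk : 2 ≤ k) (hn : 50 * k ^ 2 ≤ n) (S : Finset ℕ) (hs : 1 ≤ S.card) :
    (50 * k) ^ (S.card - 1) * (((Finset.Icc 1 n).powersetCard (k - 1)).filter (S ⊆ ·)).card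
      ≤ (n - 1).choose (k - 2) := by
  by_cases h : (S ⊆ Finset.Icc 1 n) ∧ S.card ≤ k - 1
  · refine le_trans (Nat.mul_le_mul_left _ ?_) (aux_choose n k hk hn S.card hs h.2)
    have : (n - S.card).choose (k - 1 - S.card)
        = ((Finset.Icc 1 n \ S).powersetCard (k - 1 - S.card)).card := by
      rw [Finset.card_powersetCard, Finset.card_sdiff_of_subset h.1]; simp
    rw [this]
    apply Finset.card_le_card_of_injOn (fun J => J \ S)
    · intro J hJ
      simp only [Finset.mem_coe, Finset.mem_filter, Finset.mem_powersetCard] at hJ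
      simp only [Finset.mem_coe, Finset.mem_powersetCard]
      refine ⟨Finset.sdiff_subset_sdiff hJ.1.1 (Finset.Subset.refl _), ?_⟩
      rw [Finset.card_sdiff_of_subset hJ.2, hJ.1.2]
    · intro J hJ J' hJ' he
      simp only [Finset.mem_coe, Finset.mem_filter, Finset.mem_powersetCard] at hJ hJ'
      have he : J \ S = J' \ S := he
      rw [← Finset.sdiff_union_of_subset hJ.2, he, Finset.sdiff_union_of_subset hJ'.2]
  · rw [Finset.filter_eq_empty_iff.2]
    · simp
    · intro J hJ hSJ
      rw [Finset.mem_powersetCard] at hJ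
      exact h ⟨hSJ.trans hJ.1, hJ.2 ▸ Finset.card_le_card hSJ⟩

lemma aux_sum (n k : ℕ) (hk : 2 ≤ k) (hn : 50 * k ^ 2 ≤ n) (s N : ℕ) (hs : 1 ≤ s)
    (𝒥 𝒮 : Finset (Finset ℕ)) (h𝒥 : 𝒥 ⊆ (Finset.Icc 1 n).powersetCard (k - 1))
    (h𝒮 : 𝒮.card ≤ N * k ^ (s - 1)) (hc : ∀ S ∈ 𝒮, S.card = s)
    (h : ∀ J ∈ 𝒥, ∃ S ∈ 𝒮, S ⊆ J) :
    50 ^ (s - 1) * 𝒥.card ≤ N * (n - 1).choose (k - 2) := by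
  have hsub : 𝒥 ⊆ 𝒮.biUnion
      (fun S => ((Finset.Icc 1 n).powersetCard (k - 1)).filter (S ⊆ ·)) := by
    intro J hJ
    obtain ⟨S, hS, hSJ⟩ := h J hJ
    exact Finset.mem_biUnion.2 ⟨S, hS, Finset.mem_filter.2 ⟨h𝒥 hJ, hSJ⟩⟩
  have h1 : 𝒥.card ≤ ∑ S ∈ 𝒮, (((Finset.Icc 1 n).powersetCard (k - 1)).filter (S ⊆ ·)).card :=
    (Finset.card_le_card hsub).trans Finset.card_biUnion_le
  have h2 : (50 * k) ^ (s - 1) * 𝒥.card ≤ 𝒮.card * (n - 1).choose (k - 2) := by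
    calc _ ≤ (50 * k) ^ (s - 1) *
          ∑ S ∈ 𝒮, (((Finset.Icc 1 n).powersetCard (k - 1)).filter (S ⊆ ·)).card :=
          Nat.mul_le_mul_left _ h1
      _ ≤ _ := by
        rw [Finset.mul_sum]
        refine Finset.sum_le_card_nsmul 𝒮 _ ((n - 1).choose (k - 2)) ?_
        intro S hS
        have := aux_cnt n k hk hn S (by rw [hc S hS]; exact hs)
        rwa [hc S hS] at this
  have h3 : k ^ (s - 1) * (50 ^ (s - 1) * 𝒥.card)
      ≤ k ^ (s - 1) * (N * (n - 1).choose (k - 2)) := by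
    calc _ = (50 * k) ^ (s - 1) * 𝒥.card := by rw [mul_pow]; ring
      _ ≤ _ := h2
      _ ≤ (N * k ^ (s - 1)) * (n - 1).choose (k - 2) := Nat.mul_le_mul_right _ h𝒮
      _ = _ := by ring
  exact Nat.le_of_mul_le_mul_left h3 (by positivity)

/-- transversal -/
def Tr (F : Finset (Finset ℕ)) (P : Finset ℕ) : Prop := ∀ G ∈ F, ¬ Disjoint P G

noncomputable def interTop (n k : ℕ) (F : Finset (Finset ℕ)) : Finset (Finset ℕ) :=
  open Classical in
  ((Finset.Icc 1 n).powersetCard (k - 1)).filter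
    (fun J => ∃ x y, x ≠ y ∧ x ∉ J ∧ y ∉ J ∧ insert x J ∈ F ∧ insert y J ∈ F)

lemma mem_interTop (n k : ℕ) (F : Finset (Finset ℕ)) (J : Finset ℕ) :
    J ∈ interTop n k F ↔ J ∈ (Finset.Icc 1 n).powersetCard (k - 1) ∧
      ∃ x y, x ≠ y ∧ x ∉ J ∧ y ∉ J ∧ insert x J ∈ F ∧ insert y J ∈ F := by
  classical
  unfold interTop
  exact Finset.mem_filter

lemma aux_fam (k p : ℕ) (F : Finset (Finset ℕ))
    (hF : ∀ G ∈ F, G.card = k) (z z' : ℕ) (hp : 1 ≤ p)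
    (hmin : ∀ P, z' ∉ P → Tr F (insert z P) → p ≤ P.card) (Q : Finset ℕ) :
    ∃ 𝒮 : Finset (Finset ℕ), 𝒮.card ≤ Q.card * k ^ (p - 1) ∧ (∀ S ∈ 𝒮, S.card = p) ∧
      ∀ P, ¬ Disjoint P Q → z' ∉ P → Tr F (insert z P) → ∃ S ∈ 𝒮, S ⊆ P := by
  obtain ⟨𝒮, h1, h2, h3⟩ := aux_branch2 k p hp
    ((F.filter (fun G => z ∉ G)).image (fun G => G.erase z')) (by
      intro G hG
      obtain ⟨G', hG', rfl⟩ := Finset.mem_image.1 hG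
      rw [← hF G' (Finset.mem_filter.1 hG').1]
      exact Finset.card_le_card (Finset.erase_subset _ _)) Q (by
      intro S hS
      by_contra hcon
      push Not at hcon
      have := hmin (S.erase z') (by simp) (by
        intro G hG
        by_cases hz : z ∈ G
        · exact Finset.not_disjoint_iff.2 ⟨z, by simp, hz⟩
        · obtain ⟨a, ha, ha'⟩ := Finset.not_disjoint_iff.1 (hcon (G.erase z')
            (Finset.mem_image.2 ⟨G, Finset.mem_filter.2 ⟨hG, hz⟩, rfl⟩))
          rw [Finset.mem_erase] at ha'
          exact Finset.not_disjoint_iff.2 ⟨a, by simp [ha, ha'.1], ha'.2⟩)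
      have := Finset.card_le_card (Finset.erase_subset z' S)
      omega)
  refine ⟨𝒮, h1, h2, ?_⟩
  intro P hP hz' hT
  apply h3 P hP
  intro G hG
  obtain ⟨G', hG', rfl⟩ := Finset.mem_image.1 hG
  obtain ⟨hG'F, hz⟩ := Finset.mem_filter.1 hG'
  obtain ⟨a, ha, ha'⟩ := Finset.not_disjoint_iff.1 (hT G' hG'F)
  have haP : a ∈ P := by
    rcases Finset.mem_insert.1 ha with rfl | h
    · exact absurd ha' hz
    · exact h
  exact Finset.not_disjoint_iff.2 ⟨a, haP, Finset.mem_erase.2 ⟨fun h => hz' (h ▸ haP), ha'⟩⟩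

lemma aux_a (n k : ℕ) (hk : 2 ≤ k) (hn : 50 * k ^ 2 ≤ n) (F : Finset (Finset ℕ))
    (hF : ∀ G ∈ F, G.card = k) (hint : ∀ G ∈ F, Tr F G) (z z' p : ℕ) (hp : 1 ≤ p)
    (hmin : ∀ P, z' ∉ P → Tr F (insert z P) → p ≤ P.card)
    (Q : Finset ℕ) (hzQ : z ∉ Q) (hQ : Tr F (insert z' Q)) :
    50 ^ (p - 1) * ((interTop n k F).filter (fun J => z ∈ J ∧ z' ∉ J)).card
      ≤ (Q.card * p) * (n - 1).choose (k - 2) := by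
  obtain ⟨𝒮, h1, h2, h3⟩ := aux_fam k p F hF z z' hp hmin Q
  apply aux_sum n k hk hn p (Q.card * p) hp _
    ((𝒮.filter (fun S => z ∉ S)).biUnion (fun S => S.image (fun w => insert z (S.erase w))))
  · exact (Finset.filter_subset _ _).trans (fun J hJ => ((mem_interTop n k F J).1 hJ).1)
  · calc _ ≤ (𝒮.filter (fun S => z ∉ S)).card * p := by
          apply Finset.card_biUnion_le_card_mul
          intro S hS
          rw [← h2 S (Finset.mem_filter.1 hS).1]
          exact Finset.card_image_le
      _ ≤ (Q.card * k ^ (p - 1)) * p :=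
          Nat.mul_le_mul_right _ ((Finset.card_le_card (Finset.filter_subset _ _)).trans h1)
      _ = _ := by ring
  · intro S' hS'
    obtain ⟨S, hS, hS'⟩ := Finset.mem_biUnion.1 hS'
    obtain ⟨w, hw, rfl⟩ := Finset.mem_image.1 hS'
    obtain ⟨hS, hz⟩ := Finset.mem_filter.1 hS
    rw [Finset.card_insert_of_notMem (fun h => hz (Finset.mem_of_mem_erase h)),
      Finset.card_erase_of_mem hw, h2 S hS]
    omega
  · intro J hJ
    obtain ⟨hJ, hzJ, hz'J⟩ := Finset.mem_filter.1 hJ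
    obtain ⟨hJc, x0, y0, hxy, hx0, hy0, hx0F, hy0F⟩ := (mem_interTop n k F J).1 hJ
    obtain ⟨y, hy, hyz, hyF⟩ : ∃ y, y ∉ J ∧ y ≠ z' ∧ insert y J ∈ F := by
      by_cases h : x0 = z'
      · exact ⟨y0, hy0, fun h' => hxy (h.trans h'.symm), hy0F⟩
      · exact ⟨x0, hx0, h, hx0F⟩
    have hz'2 : z' ∉ insert y J := by
      simp only [Finset.mem_insert, not_or]; exact ⟨hyz.symm, hz'J⟩
    obtain ⟨S, hS, hSP⟩ := h3 ((insert y J).erase z) (by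
        obtain ⟨a, ha, ha'⟩ := Finset.not_disjoint_iff.1 (hQ _ hyF)
        have haQ : a ∈ Q := by
          rcases Finset.mem_insert.1 ha with rfl | h
          · exact absurd ha' hz'2
          · exact h
        exact Finset.not_disjoint_iff.2
          ⟨a, Finset.mem_erase.2 ⟨fun h => hzQ (h ▸ haQ), ha'⟩, haQ⟩)
      (fun h => hz'2 (Finset.mem_of_mem_erase h))
      (by
        rw [Finset.insert_erase (Finset.mem_insert_of_mem hzJ)]
        exact hint _ hyF)
    have hzS : z ∉ S := fun h => (Finset.mem_erase.1 (hSP h)).1 rfl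
    obtain ⟨w, hw, hwS⟩ : ∃ w ∈ S, ∀ a ∈ S, a = y → a = w := by
      by_cases h : y ∈ S
      · exact ⟨y, h, fun a _ h => h⟩
      · obtain ⟨w, hw⟩ := Finset.card_pos.1 (by rw [h2 S hS]; exact hp : 0 < S.card)
        exact ⟨w, hw, fun a ha h' => absurd (h' ▸ ha) h⟩
    refine ⟨insert z (S.erase w), Finset.mem_biUnion.2 ⟨S, Finset.mem_filter.2 ⟨hS, hzS⟩,
      Finset.mem_image.2 ⟨w, hw, rfl⟩⟩, ?_⟩
    apply Finset.insert_subset hzJ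
    intro a ha
    obtain ⟨haw, haS⟩ := Finset.mem_erase.1 ha
    rcases Finset.mem_insert.1 (Finset.mem_of_mem_erase (hSP haS)) with h | h
    · exact absurd (hwS a haS h) haw
    · exact h

lemma aux_c (n k : ℕ) (hk : 2 ≤ k) (hn : 50 * k ^ 2 ≤ n) (F : Finset (Finset ℕ))
    (hF : ∀ G ∈ F, G.card = k) (hint : ∀ G ∈ F, Tr F G) (z z' p : ℕ) (hzz : z ≠ z') (hp : 1 ≤ p)
    (hmin : ∀ P, z' ∉ P → Tr F (insert z P) → p ≤ P.card)
    (Q : Finset ℕ) (hzQ : z ∉ Q) (hQ : Tr F (insert z' Q)) :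
    50 ^ (p - 1) * (((Finset.Icc 1 n).powersetCard (k - 1)).filter
      (fun J => z ∉ J ∧ z' ∉ J ∧ insert z J ∈ F ∧ insert z' J ∈ F)).card
      ≤ Q.card * (n - 1).choose (k - 2) := by
  obtain ⟨𝒮, h1, h2, h3⟩ := aux_fam k p F hF z z' hp hmin Q
  apply aux_sum n k hk hn p (Q.card) hp _ 𝒮 (Finset.filter_subset _ _) h1 h2
  intro J hJ
  obtain ⟨hJc, hz, hz', hzF, hz'F⟩ := Finset.mem_filter.1 hJ
  apply h3 J _ hz' (hint _ hzF)
  obtain ⟨a, ha, ha'⟩ := Finset.not_disjoint_iff.1 (hQ _ hzF)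
  rcases Finset.mem_insert.1 ha with rfl | h
  · rcases Finset.mem_insert.1 ha' with h' | h'
    · exact absurd h'.symm hzz
    · exact absurd h' hz'
  · rcases Finset.mem_insert.1 ha' with rfl | h'
    · exact absurd h hzQ
    · exact Finset.not_disjoint_iff.2 ⟨a, h', h⟩

noncomputable def pm (F : Finset (Finset ℕ)) (z z' : ℕ) : ℕ :=
  sInf {m | ∃ P : Finset ℕ, P.card = m ∧ z ∉ P ∧ z' ∉ P ∧ Tr F (insert z P)}

lemma pm_le (F : Finset (Finset ℕ)) (z z' : ℕ) (P : Finset ℕ) (hz' : z' ∉ P)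
    (hP : Tr F (insert z P)) : pm F z z' ≤ P.card := by
  refine le_trans (Nat.sInf_le ⟨P.erase z, rfl, by simp, fun h => hz' (Finset.mem_of_mem_erase h),
    ?_⟩) (Finset.card_le_card (Finset.erase_subset z P))
  have : insert z (P.erase z) = insert z P := by
    ext a; by_cases h : a = z <;> simp [h]
  rwa [this]

lemma pm_spec (F : Finset (Finset ℕ)) (z z' : ℕ) (hzz : z ≠ z')
    (hint : ∀ G ∈ F, Tr F G) (h : ∃ G ∈ F, z ∈ G ∧ z' ∉ G) :
    ∃ P : Finset ℕ, P.card = pm F z z' ∧ z ∉ P ∧ z' ∉ P ∧ Tr F (insert z P) := by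
  obtain ⟨G, hG, hz, hz'⟩ := h
  exact Nat.sInf_mem (s := {m | ∃ P : Finset ℕ, P.card = m ∧ z ∉ P ∧ z' ∉ P ∧ Tr F (insert z P)})
    ⟨(G.erase z).card, G.erase z, rfl, by simp, fun h => hz' (Finset.mem_of_mem_erase h), by
      rw [Finset.insert_erase hz]; exact hint G hG⟩

lemma aux_num (p : ℕ) (hp : 2 ≤ p) :
    50 * ((p + 1) * p ^ 2) ≤ 12 * 50 ^ (p - 1) ∧ 50 * ((p + 1) ^ 2 * p) ≤ 18 * 50 ^ (p - 1) := by
  induction p, hp using Nat.le_induction with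
  | base => norm_num
  | succ p hp ih =>
    obtain ⟨r, rfl⟩ : ∃ r, p = r + 1 := ⟨p - 1, by omega⟩
    simp only [Nat.add_sub_cancel] at ih ⊢
    rw [pow_succ 50 r]
    constructor <;> nlinarith [ih.1, ih.2, sq_nonneg r, Nat.zero_le (r^3)]

lemma aux_top (n k : ℕ) (hk : 2 ≤ k) (hn : 50 * k ^ 2 ≤ n) (F : Finset (Finset ℕ))
    (hF : F ⊆ (Finset.Icc 1 n).powersetCard k) (hint : ∀ G ∈ F, Tr F G) (hne : F.Nonempty)
    (hsat : ∀ G ∈ (Finset.Icc 1 n).powersetCard k, Tr F G → G ∈ F)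
    (hno : ∀ a ∈ Finset.Icc 1 n, ∀ b ∈ Finset.Icc 1 n, ∀ c ∈ Finset.Icc 1 n,
      a ≠ b → a ≠ c → b ≠ c → Tr F {a, b} → Tr F {a, c} → Tr F {b, c} → False) :
    50 * (interTop n k F).card ≤ 80 * (n - 1).choose (k - 2) := by
  classical
  have hFc : ∀ G ∈ F, G.card = k := fun G hG => (Finset.mem_powersetCard.1 (hF hG)).2
  have hFX : ∀ G ∈ F, G ⊆ Finset.Icc 1 n := fun G hG => (Finset.mem_powersetCard.1 (hF hG)).1
  -- minimum transversal
  obtain ⟨T, hT, hTmin⟩ : ∃ T, Tr F T ∧ ∀ P, Tr F P → T.card ≤ P.card := by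
    obtain ⟨G, hG⟩ := hne
    have hex : ∃ m, ∃ T, Tr F T ∧ T.card = m := ⟨_, G, hint G hG, rfl⟩
    obtain ⟨T, hT, hTc⟩ := Nat.find_spec hex
    exact ⟨T, hT, fun P hP => hTc ▸ Nat.find_min' hex ⟨P, hP, rfl⟩⟩
  have hTk : T.card ≤ k := by
    obtain ⟨G, hG⟩ := hne
    exact hFc G hG ▸ hTmin G (hint G hG)
  have hT1 : 1 ≤ T.card := by
    obtain ⟨G, hG⟩ := hne
    obtain ⟨a, ha, _⟩ := Finset.not_disjoint_iff.1 (hT G hG)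
    exact Finset.card_pos.2 ⟨a, ha⟩
  -- each vertex of T has a private member
  have hpriv : ∀ z ∈ T, ∃ G ∈ F, z ∈ G ∧ ∀ w ∈ T, w ≠ z → w ∉ G := by
    intro z hz
    have h1 : ¬ Tr F (T.erase z) := fun h => by
      have := hTmin _ h
      rw [Finset.card_erase_of_mem hz] at this
      omega
    unfold Tr at h1
    push Not at h1
    obtain ⟨G, hG, hd⟩ := h1
    have h2 : ∀ w ∈ T, w ≠ z → w ∉ G := fun w hw hwz hwG =>
      Finset.disjoint_left.1 hd (Finset.mem_erase.2 ⟨hwz, hw⟩) hwG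
    obtain ⟨a, ha, ha'⟩ := Finset.not_disjoint_iff.1 (hT G hG)
    have : a = z := by
      by_contra h
      exact h2 a ha h ha'
    exact ⟨G, hG, this ▸ ha', h2⟩
  have hTX : T ⊆ Finset.Icc 1 n := fun z hz => by
    obtain ⟨G, hG, hzG, _⟩ := hpriv z hz
    exact hFX G hG hzG
  have hspec : ∀ z ∈ T, ∀ z' ∈ T, z ≠ z' →
      ∃ P : Finset ℕ, P.card = pm F z z' ∧ z ∉ P ∧ z' ∉ P ∧ Tr F (insert z P) := by
    intro z hz z' hz' hne
    obtain ⟨G, hG, hzG, h⟩ := hpriv z hz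
    exact pm_spec F z z' hne hint ⟨G, hG, hzG, h z' hz' hne.symm⟩
  have hpmT : ∀ z ∈ T, ∀ z' ∈ T, z ≠ z' → T.card ≤ pm F z z' + 1 := by
    intro z hz z' hz' hne
    obtain ⟨P, hPc, hzP, _, hP⟩ := hspec z hz z' hz' hne
    have := hTmin _ hP
    rwa [Finset.card_insert_of_notMem hzP, hPc] at this
  have hpm2 : ∀ z ∈ T, ∀ z' ∈ T, z ≠ z' → pm F z' z ≤ pm F z z' → 2 ≤ pm F z z' := by
    intro z hz z' hz' hne hle
    by_contra hlt
    have h2 : 2 ≤ T.card := Finset.one_lt_card.2 ⟨z, hz, z', hz', hne⟩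
    have h3 := hpmT z hz z' hz' hne
    have h4 := hpmT z' hz' z hz hne.symm
    obtain ⟨P, hPc, hzP, hz'P, hP⟩ := hspec z hz z' hz' hne
    obtain ⟨Q, hQc, hz'Q, hzQ, hQ⟩ := hspec z' hz' z hz hne.symm
    have hP1 : P.card = 1 := by omega
    have hQ1 : Q.card = 1 := by omega
    have hT2 : T.card = 2 := by omega
    obtain ⟨a, rfl⟩ := Finset.card_eq_one.1 hP1
    obtain ⟨b, rfl⟩ := Finset.card_eq_one.1 hQ1
    have hTe : T = {z, z'} := by
      symm
      apply Finset.eq_of_subset_of_card_le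
      · intro w hw
        simp only [Finset.mem_insert, Finset.mem_singleton] at hw
        rcases hw with rfl | rfl <;> assumption
      · rw [hT2, Finset.card_pair hne]
    simp only [Finset.mem_singleton] at hzP hz'P hzQ hz'Q
    have hmem : ∀ u v, Tr F {u, v} → v ∈ Finset.Icc 1 n := by
      intro u v huv
      by_contra hv
      have : Tr F {u} := by
        intro G hG
        obtain ⟨w, hw, hw'⟩ := Finset.not_disjoint_iff.1 (huv G hG)
        simp only [Finset.mem_insert, Finset.mem_singleton] at hw
        rcases hw with rfl | rfl
        · simpa using hw'
        · exact absurd (hFX G hG hw') hv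
      have := hTmin _ this
      simp at this
      omega
    have haX := hmem _ _ hP
    have hbX := hmem _ _ hQ
    have hab : a = b := by
      by_contra hab
      have hsub : ({z, a} : Finset ℕ) ⊆ Finset.Icc 1 n \ {z', b} := by
        intro w hw
        simp only [Finset.mem_insert, Finset.mem_singleton] at hw
        rw [Finset.mem_sdiff]
        simp only [Finset.mem_insert, Finset.mem_singleton, not_or]
        rcases hw with rfl | rfl
        · exact ⟨hTX hz, hne, hzQ⟩
        · exact ⟨haX, fun h => hz'P h.symm, hab⟩
      obtain ⟨G, hG1, hG2, hGc⟩ := Finset.exists_subsuperset_card_eq (n := k) hsub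
        (Finset.card_le_two.trans hk) (by
          have h := Finset.le_card_sdiff ({z', b} : Finset ℕ) (Finset.Icc 1 n)
          have h' : ({z', b} : Finset ℕ).card ≤ 2 := Finset.card_le_two
          rw [Nat.card_Icc] at h
          have : k + 2 ≤ n := by nlinarith
          omega)
      have hGF : G ∈ F := hsat G (Finset.mem_powersetCard.2
        ⟨hG2.trans Finset.sdiff_subset, hGc⟩) (by
          intro G' hG'
          obtain ⟨w, hw, hw'⟩ := Finset.not_disjoint_iff.1 (hP G' hG')
          exact Finset.not_disjoint_iff.2 ⟨w, hG1 hw, hw'⟩)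
      obtain ⟨w, hw, hw'⟩ := Finset.not_disjoint_iff.1 (hQ G hGF)
      exact (Finset.mem_sdiff.1 (hG2 hw')).2 hw
    subst hab
    exact hno z (hTX hz) z' (hTX hz') a haX hne hzP hz'P (hTe ▸ hT) hP hQ
  set M := (n - 1).choose (k - 2) with hM
  set τ := T.card with hτ
  let A : ℕ → ℕ → Finset (Finset ℕ) := fun z z' =>
    (interTop n k F).filter (fun J => z ∈ J ∧ z' ∉ J)
  let C : ℕ → ℕ → Finset (Finset ℕ) := fun z z' =>
    ((Finset.Icc 1 n).powersetCard (k - 1)).filter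
      (fun J => z ∉ J ∧ z' ∉ J ∧ insert z J ∈ F ∧ insert z' J ∈ F)
  have hτ0 : (0 : ℚ) < τ := by exact_mod_cast hT1
  have hA : ∀ z ∈ T, ∀ z' ∈ T, z ≠ z' → pm F z' z ≤ pm F z z' →
      ((A z z').card : ℚ) ≤ 12 * M / (50 * τ) := by
    intro z hz z' hz' hne hle
    obtain ⟨Q, hQc, hz'Q, hzQ, hQ⟩ := hspec z' hz' z hz hne.symm
    have h2 := hpm2 z hz z' hz' hne hle
    have h1 := aux_a n k hk hn F hFc hint z z' (pm F z z') (by omega) (pm_le F z z') Q hzQ hQ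
    have h3 := hpmT z hz z' hz' hne
    have h4 := (aux_num _ h2).1
    rw [le_div_iff₀ (by positivity)]
    have : (A z z').card * (50 * τ) ≤ 12 * M := by
      set p := pm F z z'
      have e : 50 ^ (p - 1) * ((A z z').card * (50 * τ)) ≤ 50 ^ (p - 1) * (12 * M) := by
        calc _ = (50 ^ (p - 1) * (A z z').card) * (50 * τ) := by ring
          _ ≤ ((Q.card * p) * M) * (50 * (p + 1)) := Nat.mul_le_mul h1 (by omega)
          _ ≤ ((p * p) * M) * (50 * (p + 1)) := by
            rw [hQc]; gcongr
          _ = (50 * ((p + 1) * p ^ 2)) * M := by ring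
          _ ≤ (12 * 50 ^ (p - 1)) * M := Nat.mul_le_mul_right _ h4
          _ = _ := by ring
      exact Nat.le_of_mul_le_mul_left e (by positivity)
    exact_mod_cast this
  have hC : ∀ z ∈ T, ∀ z' ∈ T, z ≠ z' → pm F z' z ≤ pm F z z' →
      ((C z z').card : ℚ) ≤ 18 * M / (50 * τ ^ 2) := by
    intro z hz z' hz' hne hle
    obtain ⟨Q, hQc, hz'Q, hzQ, hQ⟩ := hspec z' hz' z hz hne.symm
    have h2 := hpm2 z hz z' hz' hne hle
    have h1 := aux_c n k hk hn F hFc hint z z' (pm F z z') hne (by omega) (pm_le F z z') Q hzQ hQ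
    have h3 := hpmT z hz z' hz' hne
    have h4 := (aux_num _ h2).2
    rw [le_div_iff₀ (by positivity)]
    have : (C z z').card * (50 * τ ^ 2) ≤ 18 * M := by
      set p := pm F z z'
      have e : 50 ^ (p - 1) * ((C z z').card * (50 * τ ^ 2)) ≤ 50 ^ (p - 1) * (18 * M) := by
        calc _ = (50 ^ (p - 1) * (C z z').card) * (50 * τ ^ 2) := by ring
          _ ≤ (Q.card * M) * (50 * (p + 1) ^ 2) := Nat.mul_le_mul h1 (by gcongr)
          _ ≤ (p * M) * (50 * (p + 1) ^ 2) := by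
            rw [hQc]; gcongr
          _ = (50 * ((p + 1) ^ 2 * p)) * M := by ring
          _ ≤ (18 * 50 ^ (p - 1)) * M := Nat.mul_le_mul_right _ h4
          _ = _ := by ring
      exact Nat.le_of_mul_le_mul_left e (by positivity)
    exact_mod_cast this
  let D : ℕ × ℕ → Prop := fun q => q.1 ≠ q.2 ∧ pm F q.2 q.1 ≤ pm F q.1 q.2
  let CC := ((T ×ˢ T).filter D).biUnion (fun q => C q.1 q.2)
  have hCC : (CC.card : ℚ) ≤ 18 * M / 50 := by
    have h1 : (CC.card : ℚ) ≤ ∑ q ∈ (T ×ˢ T).filter D, ((C q.1 q.2).card : ℚ) := by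
      exact_mod_cast Finset.card_biUnion_le
    have h2 : ∑ q ∈ (T ×ˢ T).filter D, ((C q.1 q.2).card : ℚ) ≤
        ((T ×ˢ T).filter D).card • (18 * M / (50 * τ ^ 2) : ℚ) := by
      apply Finset.sum_le_card_nsmul
      intro q hq
      obtain ⟨hq, hD⟩ := Finset.mem_filter.1 hq
      obtain ⟨hq1, hq2⟩ := Finset.mem_product.1 hq
      exact hC _ hq1 _ hq2 hD.1 hD.2
    have h3 : (((T ×ˢ T).filter D).card : ℚ) ≤ τ ^ 2 := by
      have := Finset.card_le_card (Finset.filter_subset D (T ×ˢ T))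
      rw [Finset.card_product] at this
      rw [sq]
      exact_mod_cast this
    rw [nsmul_eq_mul] at h2
    calc _ ≤ _ := h1
      _ ≤ _ := h2
      _ ≤ (τ : ℚ) ^ 2 * (18 * M / (50 * τ ^ 2) : ℚ) :=
          mul_le_mul_of_nonneg_right h3 (by positivity)
      _ = _ := by field_simp
  -- J disjoint from T
  have hdis : ∀ J ∈ interTop n k F, Disjoint T J → J ∈ CC := by
    intro J hJ hd
    obtain ⟨hJc, x, y, hxy, hx, hy, hxF, hyF⟩ := (mem_interTop n k F J).1 hJ
    have hh : ∀ u, insert u J ∈ F → u ∈ T := by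
      intro u hu
      obtain ⟨w, hw, hw'⟩ := Finset.not_disjoint_iff.1 (hT _ hu)
      rcases Finset.mem_insert.1 hw' with rfl | h
      · exact hw
      · exact absurd h (Finset.disjoint_left.1 hd hw)
    have hxT := hh x hxF
    have hyT := hh y hyF
    rcases le_total (pm F y x) (pm F x y) with h | h
    · exact Finset.mem_biUnion.2 ⟨(x, y), Finset.mem_filter.2
        ⟨Finset.mem_product.2 ⟨hxT, hyT⟩, hxy, h⟩,
        Finset.mem_filter.2 ⟨hJc, hx, hy, hxF, hyF⟩⟩
    · exact Finset.mem_biUnion.2 ⟨(y, x), Finset.mem_filter.2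
        ⟨Finset.mem_product.2 ⟨hyT, hxT⟩, hxy.symm, h⟩,
        Finset.mem_filter.2 ⟨hJc, hy, hx, hyF, hxF⟩⟩
  have hfin : ((interTop n k F).card : ℚ) ≤ 80 * M / 50 := by
    by_cases hcase : ∃ s ∈ T, ∀ z ∈ T, z ≠ s → pm F s z ≤ pm F z s
    · obtain ⟨s, hs, hgood⟩ := hcase
      let B0 := ((Finset.Icc 1 n).powersetCard (k - 1)).filter (({s} : Finset ℕ) ⊆ ·)
      let AA := (T.erase s).biUnion (fun z => A z s)
      have hsub : interTop n k F ⊆ B0 ∪ (AA ∪ CC) := by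
        intro J hJ
        have hJc := ((mem_interTop n k F J).1 hJ).1
        by_cases hsJ : s ∈ J
        · exact Finset.mem_union_left _ (Finset.mem_filter.2 ⟨hJc, by simpa using hsJ⟩)
        · apply Finset.mem_union_right
          by_cases hd : Disjoint T J
          · exact Finset.mem_union_right _ (hdis J hJ hd)
          · obtain ⟨z, hz, hzJ⟩ := Finset.not_disjoint_iff.1 hd
            exact Finset.mem_union_left _ (Finset.mem_biUnion.2 ⟨z,
              Finset.mem_erase.2 ⟨fun h => hsJ (h ▸ hzJ), hz⟩,
              Finset.mem_filter.2 ⟨hJ, hzJ, hsJ⟩⟩)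
      have hB : (B0.card : ℚ) ≤ M := by
        have := aux_cnt n k hk hn {s} (by simp)
        simp only [Finset.card_singleton, Nat.sub_self, pow_zero, one_mul] at this
        exact_mod_cast this
      have hAA : (AA.card : ℚ) ≤ 12 * M / 50 := by
        have h1 : (AA.card : ℚ) ≤ ∑ z ∈ T.erase s, ((A z s).card : ℚ) := by
          exact_mod_cast Finset.card_biUnion_le
        have h2 : ∑ z ∈ T.erase s, ((A z s).card : ℚ) ≤
            (T.erase s).card • (12 * M / (50 * τ) : ℚ) := by
          apply Finset.sum_le_card_nsmul
          intro z hz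
          obtain ⟨hzs, hz⟩ := Finset.mem_erase.1 hz
          exact hA z hz s hs hzs (hgood z hz hzs)
        have h3 : ((T.erase s).card : ℚ) ≤ τ := by
          exact_mod_cast Finset.card_le_card (Finset.erase_subset s T)
        rw [nsmul_eq_mul] at h2
        calc _ ≤ _ := h1
          _ ≤ _ := h2
          _ ≤ (τ : ℚ) * (12 * M / (50 * τ) : ℚ) :=
              mul_le_mul_of_nonneg_right h3 (by positivity)
          _ = _ := by field_simp
      have hcard : ((interTop n k F).card : ℚ) ≤ B0.card + (AA.card + CC.card) := by
        have h1 := Finset.card_le_card hsub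
        have h2 := Finset.card_union_le B0 (AA ∪ CC)
        have h3 := Finset.card_union_le AA CC
        exact_mod_cast (by omega : (interTop n k F).card ≤ B0.card + (AA.card + CC.card))
      linarith
    · push Not at hcase
      have hcase' : ∀ s : ℕ, ∃ z, s ∈ T → z ∈ T ∧ z ≠ s ∧ pm F z s < pm F s z := by
        intro s
        by_cases hs : s ∈ T
        · obtain ⟨z, hz⟩ := hcase s hs
          exact ⟨z, fun _ => hz⟩
        · exact ⟨0, fun h => absurd h hs⟩
      choose w hw using hcase'
      let B : ℕ → Finset (Finset ℕ) := fun z =>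
        ((Finset.Icc 1 n).powersetCard (k - 1)).filter (({z, w z} : Finset ℕ) ⊆ ·)
      let AA := T.biUnion (fun z => A z (w z) ∪ B z)
      have hsub : interTop n k F ⊆ AA ∪ CC := by
        intro J hJ
        have hJc := ((mem_interTop n k F J).1 hJ).1
        by_cases hd : Disjoint T J
        · exact Finset.mem_union_right _ (hdis J hJ hd)
        · obtain ⟨z, hz, hzJ⟩ := Finset.not_disjoint_iff.1 hd
          refine Finset.mem_union_left _ (Finset.mem_biUnion.2 ⟨z, hz, ?_⟩)
          by_cases hwJ : w z ∈ J
          · refine Finset.mem_union_right _ (Finset.mem_filter.2 ⟨hJc, ?_⟩)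
            intro u hu
            simp only [Finset.mem_insert, Finset.mem_singleton] at hu
            rcases hu with rfl | rfl <;> assumption
          · exact Finset.mem_union_left _ (Finset.mem_filter.2 ⟨hJ, hzJ, hwJ⟩)
      have hB : ∀ z ∈ T, ((B z).card : ℚ) ≤ M / (50 * τ) := by
        intro z hz
        have h := aux_cnt n k hk hn {z, w z} (by rw [Finset.card_pair (hw z hz).2.1.symm]; omega)
        rw [Finset.card_pair (hw z hz).2.1.symm] at h
        simp only [Nat.add_one_sub_one, pow_one] at h
        rw [le_div_iff₀ (by positivity)]
        have : (B z).card * (50 * τ) ≤ M := by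
          calc _ ≤ (B z).card * (50 * k) := by gcongr
            _ = 50 * k * (B z).card := by ring
            _ ≤ M := h
        exact_mod_cast this
      have hAA : (AA.card : ℚ) ≤ 13 * M / 50 := by
        have h1 : (AA.card : ℚ) ≤ ∑ z ∈ T, ((A z (w z) ∪ B z).card : ℚ) := by
          exact_mod_cast Finset.card_biUnion_le
        have h2 : ∑ z ∈ T, ((A z (w z) ∪ B z).card : ℚ) ≤
            T.card • (13 * M / (50 * τ) : ℚ) := by
          apply Finset.sum_le_card_nsmul
          intro z hz
          have e1 := hA z hz (w z) (hw z hz).1 (hw z hz).2.1.symm (hw z hz).2.2.le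
          have e2 := hB z hz
          have e3 : ((A z (w z) ∪ B z).card : ℚ) ≤ (A z (w z)).card + (B z).card := by
            exact_mod_cast Finset.card_union_le _ _
          have e4 : (13 * M / (50 * τ) : ℚ) = 12 * M / (50 * τ) + M / (50 * τ) := by ring
          linarith
        rw [nsmul_eq_mul] at h2
        calc _ ≤ _ := h1
          _ ≤ _ := h2
          _ = (τ : ℚ) * (13 * M / (50 * τ) : ℚ) := rfl
          _ = _ := by field_simp
      have hcard : ((interTop n k F).card : ℚ) ≤ AA.card + CC.card := by
        have h1 := Finset.card_le_card hsub
        have h3 := Finset.card_union_le AA CC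
        exact_mod_cast h1.trans h3
      have : (0 : ℚ) ≤ M := by positivity
      linarith
  rw [le_div_iff₀ (by norm_num)] at hfin
  have : (interTop n k F).card * 50 ≤ 80 * M := by exact_mod_cast hfin
  omega

lemma aux_inter (n k : ℕ) (hk : 2 ≤ k) (F : Finset (Finset ℕ))
    (hF : F ⊆ (Finset.Icc 1 n).powersetCard k) :
    interFam F ⊆ interTop n k F ∪
      (Finset.range (k - 1)).biUnion (fun i => (Finset.Icc 1 n).powersetCard i) := by
  intro I hI
  obtain ⟨⟨G, G'⟩, hp, rfl⟩ := Finset.mem_image.1 hI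
  obtain ⟨hp, hne⟩ := Finset.mem_filter.1 hp
  obtain ⟨hG, hG'⟩ := Finset.mem_product.1 hp
  simp only at hG hG' hne ⊢
  obtain ⟨hGX, hGc⟩ := Finset.mem_powersetCard.1 (hF hG)
  obtain ⟨hG'X, hG'c⟩ := Finset.mem_powersetCard.1 (hF hG')
  have hX : G ∩ G' ⊆ Finset.Icc 1 n := Finset.inter_subset_left.trans hGX
  have h1 := Finset.card_sdiff_add_card_inter G G'
  have h2 := Finset.card_sdiff_add_card_inter G' G
  rw [Finset.inter_comm G' G] at h2
  by_cases hlt : (G ∩ G').card < k - 1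
  · exact Finset.mem_union_right _ (Finset.mem_biUnion.2 ⟨_, Finset.mem_range.2 hlt,
      Finset.mem_powersetCard.2 ⟨hX, rfl⟩⟩)
  · have h3 : (G \ G').card ≠ 0 := by
      intro h
      rw [Finset.card_eq_zero, Finset.sdiff_eq_empty_iff_subset] at h
      exact hne (Finset.eq_of_subset_of_card_le h (by omega))
    obtain ⟨x, hx⟩ := Finset.card_eq_one.1 (by omega : (G \ G').card = 1)
    obtain ⟨y, hy⟩ := Finset.card_eq_one.1 (by omega : (G' \ G).card = 1)
    have hxm : x ∈ G \ G' := by rw [hx]; simp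
    have hym : y ∈ G' \ G := by rw [hy]; simp
    rw [Finset.mem_sdiff] at hxm hym
    have e1 : insert x (G ∩ G') = G := by
      rw [Finset.insert_eq, ← hx]; exact Finset.sdiff_union_inter G G'
    have e2 : insert y (G ∩ G') = G' := by
      rw [Finset.insert_eq, ← hy, Finset.inter_comm]; exact Finset.sdiff_union_inter G' G
    refine Finset.mem_union_left _ ((mem_interTop _ _ _ _).2 ⟨Finset.mem_powersetCard.2
      ⟨hX, by omega⟩, x, y, ?_, ?_, ?_, ?_, ?_⟩)
    · rintro rfl; exact hxm.2 hym.1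
    · simp [hxm.2]
    · simp [hym.2]
    · rwa [e1]
    · rwa [e2]

lemma aux_small (n k : ℕ) (hk : 2 ≤ k) (hn : 50 * k ^ 2 ≤ n) (m : ℕ) : m ≤ k - 2 →
    99 * ∑ i ∈ Finset.range (m + 1), n.choose i ≤ 100 * n.choose m := by
  induction m with
  | zero => intro _; simp
  | succ m ih =>
    intro hm
    have h1 := ih (by omega)
    rw [Finset.sum_range_succ]
    have h2 := Nat.choose_succ_right_eq n m
    have h3 : 100 * (m + 1) ≤ n - m := by
      have : 100 * (m + 1) + m ≤ n := by nlinarith [(by omega : m + 3 ≤ k)]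
      omega
    have h4 : 100 * n.choose m ≤ n.choose (m + 1) := by
      have : (100 * n.choose m) * (m + 1) ≤ n.choose (m + 1) * (m + 1) := by
        rw [h2]; nlinarith [Nat.mul_le_mul_left (n.choose m) h3]
      exact Nat.le_of_mul_le_mul_right this (by omega)
    omega

lemma aux_shift (N j : ℕ) (h : 50 * j ≤ N + 1) :
    98 * (N + 1).choose j ≤ 100 * N.choose j := by
  have h1 := Nat.choose_mul_succ_eq N j
  have h2 : 98 * (N + 1) ≤ 100 * (N + 1 - j) := by omega
  have : (98 * (N + 1).choose j) * (N + 1) ≤ (100 * N.choose j) * (N + 1) := by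
    calc _ = (N + 1).choose j * (98 * (N + 1)) := by ring
      _ ≤ (N + 1).choose j * (100 * (N + 1 - j)) := Nat.mul_le_mul_left _ h2
      _ = _ := by rw [mul_left_comm, ← h1]; ring
  exact Nat.le_of_mul_le_mul_right this (by omega)

lemma aux_lower (n k : ℕ) (hk : 2 ≤ k) (hn : 50 * k ^ 2 ≤ n) :
    3 * (n - 3).choose (k - 2) ≤ (interFam (((Finset.Icc 1 n).powersetCard k).filter
        (fun A => 2 ≤ (A ∩ ({1, 2, 3} : Finset ℕ)).card))).card := by
  have hn3 : 200 ≤ n := by nlinarith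
  have e : 3 * (n - 3).choose (k - 2) =
      ((({1, 2, 3} : Finset ℕ)) ×ˢ (Finset.Icc 4 n).powersetCard (k - 2)).card := by
    rw [Finset.card_product, Finset.card_powersetCard, Nat.card_Icc]
    congr 1
  rw [e]
  have hnot : ∀ C ∈ (Finset.Icc 4 n).powersetCard (k - 2), ∀ u ∈ ({1, 2, 3} : Finset ℕ),
      u ∉ C := by
    intro C hC u hu h
    have := Finset.mem_Icc.1 ((Finset.mem_powersetCard.1 hC).1 h)
    simp only [Finset.mem_insert, Finset.mem_singleton] at hu
    omega
  apply Finset.card_le_card_of_injOn (fun q => insert q.1 q.2)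
  · rintro ⟨i, C⟩ hq
    obtain ⟨hi, hC⟩ := Finset.mem_product.1 (Finset.mem_coe.1 hq)
    simp only at hi hC
    have hn' := hnot C hC
    obtain ⟨hCX, hCc⟩ := Finset.mem_powersetCard.1 hC
    obtain ⟨j, hj, l, hl, hij, hil, hjl⟩ : ∃ j ∈ ({1, 2, 3} : Finset ℕ),
        ∃ l ∈ ({1, 2, 3} : Finset ℕ), i ≠ j ∧ i ≠ l ∧ j ≠ l := by
      simp only [Finset.mem_insert, Finset.mem_singleton] at hi
      rcases hi with rfl | rfl | rfl
      · exact ⟨2, by simp, 3, by simp, by simp⟩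
      · exact ⟨1, by simp, 3, by simp, by simp⟩
      · exact ⟨1, by simp, 2, by simp, by simp⟩
    have hmem : ∀ u ∈ ({1, 2, 3} : Finset ℕ), i ≠ u → insert i (insert u C) ∈
        ((Finset.Icc 1 n).powersetCard k).filter
        (fun A => 2 ≤ (A ∩ ({1, 2, 3} : Finset ℕ)).card) := by
      intro u hu hiu
      have hX : ∀ v ∈ ({1, 2, 3} : Finset ℕ), v ∈ Finset.Icc 1 n := by
        intro v hv
        simp only [Finset.mem_insert, Finset.mem_singleton] at hv
        rw [Finset.mem_Icc]; omega
      rw [Finset.mem_filter, Finset.mem_powersetCard]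
      refine ⟨⟨?_, ?_⟩, ?_⟩
      · refine Finset.insert_subset (hX i hi) (Finset.insert_subset (hX u hu) (hCX.trans ?_))
        exact Finset.Icc_subset_Icc_left (by norm_num)
      · rw [Finset.card_insert_of_notMem, Finset.card_insert_of_notMem (hn' u hu), hCc]
        · omega
        · rw [Finset.mem_insert, not_or]; exact ⟨hiu, hn' i hi⟩
      · refine (Finset.card_pair hiu).ge.trans (Finset.card_le_card ?_)
        intro v hv
        rw [Finset.mem_insert, Finset.mem_singleton] at hv
        rcases hv with rfl | rfl
        · exact Finset.mem_inter.2 ⟨by simp, hi⟩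
        · exact Finset.mem_inter.2 ⟨by simp, hu⟩
    refine Finset.mem_coe.2 (Finset.mem_image.2 ⟨(insert i (insert j C), insert i (insert l C)),
      Finset.mem_filter.2 ⟨Finset.mem_product.2 ⟨hmem j hj hij, hmem l hl hil⟩, ?_⟩, ?_⟩)
    · intro h
      simp only at h
      have : j ∈ insert i (insert l C) := h ▸ (by simp)
      simp only [Finset.mem_insert] at this
      rcases this with h | h | h
      · exact hij h.symm
      · exact hjl h
      · exact hn' j hj h
    · simp only
      ext v
      simp only [Finset.mem_inter, Finset.mem_insert]
      constructor
      · rintro ⟨h1, h2⟩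
        rcases h1 with h1 | h1 | h1
        · exact Or.inl h1
        · rcases h2 with h2 | h2 | h2
          · exact Or.inl h2
          · exact absurd (h1.symm.trans h2) hjl
          · exact Or.inr h2
        · exact Or.inr h1
      · rintro (h | h)
        · exact ⟨Or.inl h, Or.inl h⟩
        · exact ⟨Or.inr (Or.inr h), Or.inr (Or.inr h)⟩
  · rintro ⟨i, C⟩ hq ⟨i', C'⟩ hq' h
    obtain ⟨hi, hC⟩ := Finset.mem_product.1 (Finset.mem_coe.1 hq)
    obtain ⟨hi', hC'⟩ := Finset.mem_product.1 (Finset.mem_coe.1 hq')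
    simp only at hi hC hi' hC' h
    have hii : i = i' := by
      have : i ∈ insert i' C' := h ▸ (by simp)
      rcases Finset.mem_insert.1 this with h | h
      · exact h
      · exact absurd h (hnot C' hC' i hi)
    subst hii
    have := congrArg (fun S => S.erase i) h
    simp only [Finset.erase_insert (hnot C hC i hi), Finset.erase_insert (hnot C' hC' i hi)] at this
    rw [this]

lemma aux_mono (F F' : Finset (Finset ℕ)) (h : F ⊆ F') : interFam F ⊆ interFam F' :=
  Finset.image_subset_image (Finset.filter_subset_filter _ (Finset.product_subset_product h h))

lemma aux_perm (n a b c : ℕ) (hn : 3 ≤ n) (ha : a ∈ Finset.Icc 1 n) (hb : b ∈ Finset.Icc 1 n)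
    (hc : c ∈ Finset.Icc 1 n) (hab : a ≠ b) (hac : a ≠ c) (hbc : b ≠ c) :
    ∃ σ : Equiv.Perm ℕ, σ a = 1 ∧ σ b = 2 ∧ σ c = 3 ∧
      ∀ x ∈ Finset.Icc 1 n, σ x ∈ Finset.Icc 1 n := by
  have hsw : ∀ u ∈ Finset.Icc 1 n, ∀ v ∈ Finset.Icc 1 n, ∀ x ∈ Finset.Icc 1 n,
      Equiv.swap u v x ∈ Finset.Icc 1 n := by
    intro u hu v hv x hx
    rw [Equiv.swap_apply_def]
    split_ifs <;> assumption
  have h1 : 1 ∈ Finset.Icc 1 n := Finset.mem_Icc.2 ⟨by omega, by omega⟩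
  have h2 : 2 ∈ Finset.Icc 1 n := Finset.mem_Icc.2 ⟨by omega, by omega⟩
  have h3 : 3 ∈ Finset.Icc 1 n := Finset.mem_Icc.2 ⟨by omega, by omega⟩
  set s1 : Equiv.Perm ℕ := Equiv.swap a 1 with hs1
  have s1a : s1 a = 1 := by simp [hs1]
  have m1 : ∀ x ∈ Finset.Icc 1 n, s1 x ∈ Finset.Icc 1 n := hsw a ha 1 h1
  have b1 : s1 b ≠ 1 := fun h => hab (s1.injective (s1a.trans h.symm))
  set s2 : Equiv.Perm ℕ := Equiv.swap (s1 b) 2 with hs2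
  have s2b : s2 (s1 b) = 2 := by simp [hs2]
  have s2a : s2 1 = 1 := Equiv.swap_apply_of_ne_of_ne b1.symm (by norm_num)
  have m2 : ∀ x ∈ Finset.Icc 1 n, s2 x ∈ Finset.Icc 1 n := hsw _ (m1 b hb) 2 h2
  have c1 : s2 (s1 c) ≠ 1 := fun h =>
    hac (s1.injective (s2.injective (by rw [s1a, s2a, h])))
  have c2 : s2 (s1 c) ≠ 2 := fun h =>
    hbc (s1.injective (s2.injective (by rw [s2b, h])))
  set s3 : Equiv.Perm ℕ := Equiv.swap (s2 (s1 c)) 3 with hs3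
  refine ⟨(s1.trans s2).trans s3, ?_, ?_, ?_, ?_⟩
  · simp only [Equiv.trans_apply, s1a, s2a]
    exact Equiv.swap_apply_of_ne_of_ne c1.symm (by norm_num)
  · simp only [Equiv.trans_apply, s2b]
    exact Equiv.swap_apply_of_ne_of_ne c2.symm (by norm_num)
  · simp [hs3]
  · intro x hx
    exact hsw _ (m2 _ (m1 c hc)) 3 h3 _ (m2 _ (m1 x hx))

lemma aux_triangle (n k : ℕ) (hn : 3 ≤ n) (F : Finset (Finset ℕ))
    (hF : F ⊆ (Finset.Icc 1 n).powersetCard k) (a b c : ℕ) (ha : a ∈ Finset.Icc 1 n)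
    (hb : b ∈ Finset.Icc 1 n) (hc : c ∈ Finset.Icc 1 n) (hab : a ≠ b) (hac : a ≠ c) (hbc : b ≠ c)
    (h1 : Tr F {a, b}) (h2 : Tr F {a, c}) (h3 : Tr F {b, c}) :
    (interFam F).card ≤ (interFam (((Finset.Icc 1 n).powersetCard k).filter
        (fun A => 2 ≤ (A ∩ ({1, 2, 3} : Finset ℕ)).card))).card := by
  obtain ⟨σ, ea, eb, ec, hσ⟩ := aux_perm n a b c hn ha hb hc hab hac hbc
  have hmem : ∀ G ∈ F, G.image σ ∈ ((Finset.Icc 1 n).powersetCard k).filter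
        (fun A => 2 ≤ (A ∩ ({1, 2, 3} : Finset ℕ)).card) := by
    intro G hG
    obtain ⟨hGX, hGc⟩ := Finset.mem_powersetCard.1 (hF hG)
    rw [Finset.mem_filter, Finset.mem_powersetCard]
    refine ⟨⟨?_, by rw [Finset.card_image_of_injective _ σ.injective, hGc]⟩, ?_⟩
    · intro y hy
      obtain ⟨x, hx, rfl⟩ := Finset.mem_image.1 hy
      exact hσ x (hGX hx)
    · have key : ∀ u v : ℕ, Tr F {u, v} → u ∈ G ∨ v ∈ G := by
        intro u v h
        obtain ⟨x, hx, hx'⟩ := Finset.not_disjoint_iff.1 (h G hG)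
        rw [Finset.mem_insert, Finset.mem_singleton] at hx
        rcases hx with rfl | rfl
        · exact Or.inl hx'
        · exact Or.inr hx'
      have im : ∀ u ∈ G, σ u ∈ G.image σ := fun u hu => Finset.mem_image_of_mem _ hu
      have two : ∀ u ∈ G, ∀ v ∈ G, u ≠ v → σ u ∈ ({1, 2, 3} : Finset ℕ) →
          σ v ∈ ({1, 2, 3} : Finset ℕ) → 2 ≤ (G.image σ ∩ ({1, 2, 3} : Finset ℕ)).card := by
        intro u hu v hv huv hu' hv'
        exact Finset.one_lt_card.2 ⟨σ u, Finset.mem_inter.2 ⟨im u hu, hu'⟩, σ v,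
          Finset.mem_inter.2 ⟨im v hv, hv'⟩, fun h => huv (σ.injective h)⟩
      have ta : σ a ∈ ({1, 2, 3} : Finset ℕ) := by rw [ea]; simp
      have tb : σ b ∈ ({1, 2, 3} : Finset ℕ) := by rw [eb]; simp
      have tc : σ c ∈ ({1, 2, 3} : Finset ℕ) := by rw [ec]; simp
      rcases key a b h1 with hA | hB
      · rcases key b c h3 with hB | hC
        · exact two a hA b hB hab ta tb
        · exact two a hA c hC hac ta tc
      · rcases key a c h2 with hA | hC
        · exact two a hA b hB hab ta tb
        · exact two b hB c hC hbc tb tc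
  apply Finset.card_le_card_of_injOn (fun I => I.image σ)
  · intro I hI
    obtain ⟨⟨G, G'⟩, hp, rfl⟩ := Finset.mem_image.1 (Finset.mem_coe.1 hI)
    obtain ⟨hp, hne⟩ := Finset.mem_filter.1 hp
    obtain ⟨hG, hG'⟩ := Finset.mem_product.1 hp
    refine Finset.mem_coe.2 (Finset.mem_image.2 ⟨(G.image σ, G'.image σ),
      Finset.mem_filter.2 ⟨Finset.mem_product.2 ⟨hmem G hG, hmem G' hG'⟩, ?_⟩, ?_⟩)
    · intro h
      exact hne (Finset.image_injective σ.injective h)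
    · exact (Finset.image_inter G G' σ.injective).symm
  · intro I _ I' _ h
    exact Finset.image_injective σ.injective h

lemma aux_sat (n k : ℕ) (hk : 1 ≤ k) (F : Finset (Finset ℕ))
    (hF : F ⊆ (Finset.Icc 1 n).powersetCard k) (hint : Intersecting F) :
    ∃ F', F ⊆ F' ∧ F' ⊆ (Finset.Icc 1 n).powersetCard k ∧ (∀ G ∈ F', Tr F' G) ∧
      ∀ G ∈ (Finset.Icc 1 n).powersetCard k, Tr F' G → G ∈ F' := by
  classical
  have hint' : ∀ G ∈ F, Tr F G := by
    intro G hG G' hG'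
    rw [Finset.disjoint_iff_inter_eq_empty]
    exact (hint G hG G' hG').ne_empty
  let U := ((Finset.Icc 1 n).powersetCard k).powerset.filter
    (fun F' => F ⊆ F' ∧ ∀ G ∈ F', Tr F' G)
  obtain ⟨F', hF', hmax⟩ := Finset.exists_max_image U Finset.card
    ⟨F, Finset.mem_filter.2 ⟨Finset.mem_powerset.2 hF, Finset.Subset.refl _, hint'⟩⟩
  obtain ⟨h1, h2, h3⟩ := Finset.mem_filter.1 hF'
  rw [Finset.mem_powerset] at h1
  refine ⟨F', h2, h1, h3, ?_⟩
  intro G hG hT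
  by_contra hn
  have hGG : ¬ Disjoint G G := by
    rw [disjoint_self]
    intro h
    have := (Finset.mem_powersetCard.1 hG).2
    rw [h] at this
    simp at this
    omega
  have := hmax (insert G F') (Finset.mem_filter.2 ⟨Finset.mem_powerset.2
    (Finset.insert_subset hG h1), h2.trans (Finset.subset_insert _ _), by
      intro A hA B hB
      rcases Finset.mem_insert.1 hA with hA' | hA'
      · rcases Finset.mem_insert.1 hB with hB' | hB'
        · rw [hA', hB']; exact hGG
        · rw [hA']; exact hT B hB'
      · rcases Finset.mem_insert.1 hB with hB' | hB'
        · rw [hB']; exact fun h => hT A hA' h.symm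
        · exact h3 A hA' B hB'⟩)
  rw [Finset.card_insert_of_notMem hn] at this
  omega

theorem stmt_15 (n k : ℕ) (hk : 2 ≤ k) (hn : 50 * k ^ 2 ≤ n)
    (F : Finset (Finset ℕ)) (hF : F ⊆ (Finset.Icc 1 n).powersetCard k)
    (hint : Intersecting F) :
    (interFam F).card ≤
      (interFam (((Finset.Icc 1 n).powersetCard k).filter
        (fun A => 2 ≤ (A ∩ ({1, 2, 3} : Finset ℕ)).card))).card := by
  obtain ⟨F', hFF', hF', hint', hsat⟩ := aux_sat n k (by omega) F hF hint
  refine (Finset.card_le_card (aux_mono F F' hFF')).trans ?_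
  have hn200 : 200 ≤ n := by nlinarith
  rcases F'.eq_empty_or_nonempty with rfl | hne
  · simp [interFam]
  by_cases htri : ∃ a ∈ Finset.Icc 1 n, ∃ b ∈ Finset.Icc 1 n, ∃ c ∈ Finset.Icc 1 n,
      a ≠ b ∧ a ≠ c ∧ b ≠ c ∧ Tr F' {a, b} ∧ Tr F' {a, c} ∧ Tr F' {b, c}
  · obtain ⟨a, ha, b, hb, c, hc, hab, hac, hbc, h1, h2, h3⟩ := htri
    exact aux_triangle n k (by omega) F' hF' a b c ha hb hc hab hac hbc h1 h2 h3
  · have htop := aux_top n k hk hn F' hF' hint' hne hsat (by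
      intro a ha b hb c hc hab hac hbc h1 h2 h3
      exact htri ⟨a, ha, b, hb, c, hc, hab, hac, hbc, h1, h2, h3⟩)
    refine le_trans ?_ (aux_lower n k hk hn)
    have h1 := Finset.card_le_card (aux_inter n k hk F' hF')
    have h2 := h1.trans (Finset.card_union_le _ _)
    have h3 : ((Finset.range (k - 1)).biUnion
        (fun i => (Finset.Icc 1 n).powersetCard i)).card ≤
        ∑ i ∈ Finset.range (k - 2 + 1), n.choose i := by
      refine Finset.card_biUnion_le.trans ?_
      rw [show k - 2 + 1 = k - 1 by omega]
      apply Finset.sum_le_sum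
      intro i _
      simp
    have h4 := aux_small n k hk hn (k - 2) le_rfl
    obtain ⟨N, rfl⟩ : ∃ N, n = N + 3 := ⟨n - 3, by omega⟩
    have hj : 50 * (k - 2) + 3 ≤ N := by
      have : 50 * k + 6 ≤ N + 3 := by nlinarith
      omega
    have s1 := aux_shift N (k - 2) (by omega)
    have s2 := aux_shift (N + 1) (k - 2) (by omega)
    have s3 := aux_shift (N + 2) (k - 2) (by omega)
    have h5 : (N + 2).choose (k - 2) ≤ (N + 3).choose (k - 2) :=
      Nat.choose_le_choose _ (by omega)
    simp only [Nat.add_sub_cancel] at htop ⊢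
    rw [show N + 3 - 1 = N + 2 by omega] at htop
    rw [show N + 1 + 1 = N + 2 by omega] at s2
    rw [show N + 2 + 1 = N + 3 by omega] at s3
    omega
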